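/- Let p ∈ [1,∞) and let φ be a nonnegative function in L¹_loc(0,∞) with support contained in [0,1] and ∫₀^1 t^{1/p−1} φ(t) dt < ∞. Then the operator norm of 𝓗_φ on H_a^p(ℂ₊) equals ∫₀^1 t^{1/p−1} φ(t) dt. -/

import Mathlib

open MeasureTheory Complex Filter Set Topology ENNReal NNReal

/-- The Hardy norm on the upper half-plane: `sup_{y>0} ‖f (· + iy)‖_{L^p(ℝ)}`
(for `p = ∞` this is the sup norm, via the essential supremum on each horizontal line). -/
noncomputable def hardyNorm (p : ℝ≥0∞) (f : ℂ → ℂ) : ℝ≥0∞ :=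
  ⨆ y ∈ Set.Ioi (0 : ℝ), eLpNorm (fun x : ℝ => f (x + y * Complex.I)) p volume

/-- Membership in the holomorphic Hardy space `H_a^p(ℂ₊)`. -/
def MemHardy (p : ℝ≥0∞) (f : ℂ → ℂ) : Prop :=
  DifferentiableOn ℂ f {z : ℂ | 0 < z.im} ∧ hardyNorm p f < ⊤

/-- The Hausdorff operator on holomorphic functions on the upper half-plane:
`𝓗_φ f (z) = ∫₀^∞ f(z/t) φ(t)/t dt`. -/
noncomputable def hausdorffC (φ : ℝ → ℝ) (f : ℂ → ℂ) (z : ℂ) : ℂ :=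
  ∫ t in Set.Ioi (0 : ℝ), (φ t / t) • f (z / (t : ℂ))


lemma hh_scale (g : ℝ → ℝ≥0∞) (hg : Measurable g) {t : ℝ} (ht : 0 < t) :
    ∫⁻ x, g (x / t) = ENNReal.ofReal t * ∫⁻ x, g x := by
  have h := Real.map_volume_mul_left (a := t⁻¹) (inv_ne_zero ht.ne')
  have h2 : ∫⁻ x, g x ∂(Measure.map (t⁻¹ * ·) volume) = ∫⁻ x, g (t⁻¹ * x) :=
    lintegral_map hg (measurable_const_mul _)
  rw [h, lintegral_smul_measure, inv_inv, abs_of_pos ht] at h2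
  simp only [div_eq_inv_mul]
  rw [← h2]; rfl

lemma hh_upper (p : ℝ≥0∞) (hp : 1 ≤ p) (hptop : p ≠ ⊤)
    (φ : ℝ → ℝ) (hφ : ∀ t, 0 ≤ φ t)
    (hsupp : ∀ t : ℝ, 1 < t → φ t = 0)
    (hint : IntegrableOn (fun t : ℝ => t ^ ((1 / p).toReal - 1) * φ t) (Set.Ioc 0 1))
    (f : ℂ → ℂ) (hf : DifferentiableOn ℂ f {z : ℂ | 0 < z.im}) {y : ℝ} (hy : 0 < y) :
    eLpNorm (fun x : ℝ => hausdorffC φ f (x + y * Complex.I)) p volume ≤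
      ENNReal.ofReal (∫ t in Set.Ioc (0 : ℝ) 1, t ^ ((1 / p).toReal - 1) * φ t) *
        hardyNorm p f := by
  have hp0 : p ≠ 0 := (zero_lt_one.trans_le hp).ne'
  set q := p.toReal with hq
  have hq1 : 1 ≤ q := by
    have := ENNReal.toReal_mono hptop hp
    simpa using this
  have hq0 : 0 < q := by linarith
  have ha : (1 / p).toReal = 1 / q := by simp [hq]
  set w : ℝ → ℝ := fun t => t ^ ((1 / p).toReal - 1) * φ t with hw
  set μ : Measure ℝ := (volume.restrict (Ioc (0:ℝ) 1)).withDensity (fun t => ENNReal.ofReal (w t))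
    with hμ
  have hwm : AEMeasurable (fun t => ENNReal.ofReal (w t)) (volume.restrict (Ioc (0:ℝ) 1)) :=
    hint.aestronglyMeasurable.aemeasurable.ennreal_ofReal
  have hμfin : IsFiniteMeasure μ := isFiniteMeasure_withDensity_ofReal hint.2
  have hw0 : ∀ᵐ t ∂(volume.restrict (Ioc (0:ℝ) 1)), 0 ≤ w t := by
    filter_upwards [ae_restrict_mem measurableSet_Ioc] with t ht
    exact mul_nonneg (Real.rpow_nonneg ht.1.le _) (hφ t)
  have hμuniv : μ univ = ENNReal.ofReal (∫ t in Set.Ioc (0 : ℝ) 1, w t) := by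
    rw [hμ, withDensity_apply _ MeasurableSet.univ, Measure.restrict_univ,
      ofReal_integral_eq_lintegral_ofReal hint hw0]
  rw [← hμuniv]
  set N := hardyNorm p f with hN
  set U : Set ℂ := {z : ℂ | 0 < z.im} with hU
  have hUo : IsOpen U := isOpen_lt continuous_const Complex.continuous_im
  set F : ℂ → ℂ := U.indicator f with hF
  have hFm : Measurable F := by
    have : Measurable (U.piecewise f (fun _ => (0:ℂ))) :=
      ContinuousOn.measurable_piecewise hf.continuousOn continuousOn_const hUo.measurableSet
    have e : U.piecewise f (fun _ => (0:ℂ)) = F := Set.piecewise_eq_indicator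
    rwa [e] at this
  have him : ∀ (x t : ℝ), 0 < t → ((x + y * Complex.I : ℂ) / (t:ℂ)) ∈ U := by
    intro x t ht
    simp only [hU, mem_ofPred_eq, Complex.div_ofReal_im]
    simp
    positivity
  -- the kernel
  set h : ℝ → ℝ → ℝ≥0∞ := fun x t => ENNReal.ofReal (t ^ (-(1/q))) *
    ‖F ((x + y * Complex.I : ℂ) / (t:ℂ))‖ₑ with hh
  have hhm : Measurable (Function.uncurry h) := by
    simp only [hh, Function.uncurry_def]
    refine Measurable.fun_mul ?_ ?_
    · exact (measurable_snd.pow_const _).ennreal_ofReal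
    · refine (hFm.comp ?_).enorm
      refine Measurable.div ?_ ?_
      · exact ((Complex.measurable_ofReal.comp measurable_fst).add measurable_const)
      · exact Complex.measurable_ofReal.comp measurable_snd
  have hhm1 : ∀ x, Measurable (h x) := fun x => hhm.comp measurable_prodMk_left
  have hpt : ∀ x : ℝ, ‖hausdorffC φ f (x + y * Complex.I)‖ₑ ≤ ∫⁻ t, h x t ∂μ := by
    intro x
    have e1 : hausdorffC φ f (x + y * Complex.I) =
        ∫ t in Ioc (0:ℝ) 1, (φ t / t) • f ((x + y * Complex.I) / (t:ℂ)) := by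
      unfold hausdorffC
      refine setIntegral_eq_of_subset_of_forall_sdiff_eq_zero measurableSet_Ioi
        (fun t ht => ht.1) ?_
      intro t ht
      have : 1 < t := by
        by_contra hcon
        exact ht.2 ⟨ht.1, not_lt.1 hcon⟩
      simp [hsupp t this]
    rw [e1]
    refine (enorm_integral_le_lintegral_enorm _).trans ?_
    rw [hμ, lintegral_withDensity_eq_lintegral_mul₀ hwm (hhm1 x).aemeasurable]
    refine setLIntegral_mono' measurableSet_Ioc ?_
    intro t ht
    simp only [Pi.mul_apply, hh]
    rw [← mul_assoc, ← ENNReal.ofReal_mul (mul_nonneg (Real.rpow_nonneg ht.1.le _) (hφ t)),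
      enorm_smul, hF, Set.indicator_of_mem (him x t ht.1)]
    refine le_of_eq ?_
    congr 1
    rw [Real.enorm_eq_ofReal (div_nonneg (hφ t) ht.1.le)]
    congr 1
    rw [ha]
    have : t ^ (1/q - 1) * t ^ (-(1/q)) = t⁻¹ := by
      rw [← Real.rpow_add ht.1, ← Real.rpow_neg_one]; congr 1; ring
    calc φ t / t = φ t * t⁻¹ := rfl
      _ = φ t * (t ^ (1/q - 1) * t ^ (-(1/q))) := by rw [this]
      _ = _ := by ring
  have hjensen : ∀ x : ℝ, (∫⁻ t, h x t ∂μ) ^ q ≤ μ univ ^ (q - 1) * ∫⁻ t, h x t ^ q ∂μ := by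
    intro x
    have := eLpNorm_le_eLpNorm_mul_rpow_measure_univ (μ := μ) hp (hhm1 x).aestronglyMeasurable
    rw [eLpNorm_one_eq_lintegral_enorm, eLpNorm_eq_lintegral_rpow_enorm_toReal hp0 hptop] at this
    simp only [enorm_eq_self, ENNReal.toReal_one, ← hq] at this
    have h2 := ENNReal.rpow_le_rpow this hq0.le
    rw [ENNReal.mul_rpow_of_nonneg _ _ hq0.le, ← ENNReal.rpow_mul, ← ENNReal.rpow_mul] at h2
    have e1 : 1 / q * q = 1 := by field_simp
    have e2 : (1 / 1 - 1 / q) * q = q - 1 := by field_simp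
    rw [e1, e2, ENNReal.rpow_one, mul_comm] at h2
    exact h2
  have hline : ∀ t ∈ Ioc (0:ℝ) 1, ∫⁻ x, h x t ^ q ≤ N ^ q := by
    intro t ht
    have hyt : 0 < y / t := div_pos hy ht.1
    set g : ℝ → ℝ≥0∞ := fun u => ‖F (u + (y/t : ℝ) * Complex.I)‖ₑ ^ q with hg
    have hgm : Measurable g := by
      refine Measurable.pow_const ?_ _
      refine (hFm.comp ?_).enorm
      exact Complex.measurable_ofReal.add measurable_const
    have e1 : ∀ x, h x t ^ q = ENNReal.ofReal t⁻¹ * g (x / t) := by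
      intro x
      simp only [hh, hg]
      rw [ENNReal.mul_rpow_of_nonneg _ _ hq0.le, ENNReal.ofReal_rpow_of_nonneg
        (Real.rpow_nonneg ht.1.le _) hq0.le, ← Real.rpow_mul ht.1.le]
      have e1 : -(1 / q) * q = -1 := by field_simp
      rw [e1, Real.rpow_neg_one]
      congr 4
      push_cast
      ring
    simp only [e1]
    rw [lintegral_const_mul' _ _ ENNReal.ofReal_ne_top, hh_scale g hgm ht.1, ← mul_assoc,
      ← ENNReal.ofReal_mul (inv_nonneg.2 ht.1.le), inv_mul_cancel₀ ht.1.ne', ENNReal.ofReal_one,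
      one_mul]
    have e2 : eLpNorm (fun x : ℝ => f (x + (y/t : ℝ) * Complex.I)) p volume ≤ N := by
      rw [hN]
      unfold hardyNorm
      exact le_iSup₂ (f := fun (y : ℝ) (_ : y ∈ Set.Ioi (0:ℝ)) =>
        eLpNorm (fun x : ℝ => f (x + y * Complex.I)) p volume) (y/t) hyt
    rw [eLpNorm_eq_lintegral_rpow_enorm_toReal hp0 hptop, ← hq] at e2
    have h2 := ENNReal.rpow_le_rpow e2 hq0.le
    rw [← ENNReal.rpow_mul, one_div_mul_cancel hq0.ne', ENNReal.rpow_one] at h2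
    refine le_trans (le_of_eq ?_) h2
    refine lintegral_congr fun u => ?_
    simp only [hg, hF]
    rw [Set.indicator_of_mem]
    simp only [hU, mem_ofPred_eq]
    simpa using hyt
  rw [eLpNorm_eq_lintegral_rpow_enorm_toReal hp0 hptop, ← hq]
  have hfinal : ∫⁻ x : ℝ, ‖hausdorffC φ f (x + y * Complex.I)‖ₑ ^ q ≤ (μ univ * N) ^ q := by
    calc ∫⁻ x : ℝ, ‖hausdorffC φ f (x + y * Complex.I)‖ₑ ^ q
        ≤ ∫⁻ x : ℝ, μ univ ^ (q - 1) * ∫⁻ t, h x t ^ q ∂μ :=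
          lintegral_mono fun x => (ENNReal.rpow_le_rpow (hpt x) hq0.le).trans (hjensen x)
      _ = μ univ ^ (q - 1) * ∫⁻ x : ℝ, ∫⁻ t, h x t ^ q ∂μ :=
          lintegral_const_mul' _ _ (ENNReal.rpow_ne_top_of_nonneg (by linarith)
            (measure_ne_top _ _))
      _ = μ univ ^ (q - 1) * ∫⁻ t, ∫⁻ x : ℝ, h x t ^ q ∂volume ∂μ := by
          rw [lintegral_lintegral_swap]
          exact (hhm.pow_const q).aemeasurable
      _ ≤ μ univ ^ (q - 1) * ∫⁻ t, N ^ q ∂μ := by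
          refine mul_le_mul_right ?_ _
          refine lintegral_mono_ae ?_
          have hac : μ ≪ volume.restrict (Ioc (0:ℝ) 1) := withDensity_absolutelyContinuous _ _
          refine hac.ae_le ?_
          filter_upwards [ae_restrict_mem measurableSet_Ioc] with t ht
          exact hline t ht
      _ = (μ univ * N) ^ q := by
          rw [lintegral_const, ENNReal.mul_rpow_of_nonneg _ _ hq0.le, mul_comm (N ^ q), ← mul_assoc]
          congr 1
          nth_rewrite 2 [← ENNReal.rpow_one (μ univ)]
          rw [← ENNReal.rpow_add_of_nonneg _ _ (by linarith) zero_le_one]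
          congr 1; ring
  calc _ ≤ ((μ univ * N) ^ q) ^ (1 / q) := ENNReal.rpow_le_rpow hfinal (by positivity)
    _ = _ := by rw [← ENNReal.rpow_mul, mul_one_div_cancel hq0.ne', ENNReal.rpow_one]

/-- Test function. -/
noncomputable def hhF (s : ℝ) (z : ℂ) : ℂ := (1 - Complex.I * z) ^ ((-s : ℝ) : ℂ)

lemma hh_mul_cpow {a b : ℂ} (ha : 0 < a.re) (hb : 0 < b.re) (c : ℂ) :
    (a * b) ^ c = a ^ c * b ^ c := by
  have ha0 : a ≠ 0 := by rintro rfl; simp at ha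
  have hb0 : b ≠ 0 := by rintro rfl; simp at hb
  have h1 := abs_lt.1 (Complex.abs_arg_lt_pi_div_two_iff.2 (Or.inl ha))
  have h2 := abs_lt.1 (Complex.abs_arg_lt_pi_div_two_iff.2 (Or.inl hb))
  rw [Complex.cpow_def_of_ne_zero (mul_ne_zero ha0 hb0), Complex.cpow_def_of_ne_zero ha0,
    Complex.cpow_def_of_ne_zero hb0, Complex.log_mul ha0 hb0 ⟨by linarith, by linarith⟩,
    ← Complex.exp_add]
  congr 1; ring

lemma hh_pointwise (φ : ℝ → ℝ) (hφ : ∀ t, 0 ≤ φ t)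
    (hsupp : ∀ t : ℝ, 1 < t → φ t = 0) (s : ℝ)
    (hint : IntegrableOn (fun t : ℝ => t ^ (s - 1) * φ t) (Set.Ioc 0 1))
    (η δ : ℝ) (hδ0 : 0 < δ) (hδ1 : δ ≤ 1)
    (hδ : ∀ w : ℂ, ‖w - 1‖ < δ → ‖w ^ ((-s : ℝ) : ℂ) - 1‖ ≤ η)
    (z : ℂ) (hz : 0 < z.im) (hzb : 1 / δ < ‖1 - Complex.I * z‖) :
    (1 - η) * (∫ t in Ioc (0:ℝ) 1, t ^ (s - 1) * φ t) * ‖hhF s z‖ ≤ ‖hausdorffC φ (hhF s) z‖ := by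
  set g : ℝ → ℝ := fun t => t ^ (s - 1) * φ t with hg
  set a : ℂ := 1 - Complex.I * z with ha
  have hare : 0 < a.re := by simp [ha]; linarith
  have ha0 : a ≠ 0 := by intro h; rw [h] at hare; simp at hare
  set w : ℝ → ℂ := fun t => 1 - (1 - t) / a with hwdef
  have hw1 : ∀ t ∈ Ioc (0:ℝ) 1, ‖w t - 1‖ < δ := by
    intro t ht
    have e : w t - 1 = -(((1 - t : ℝ) : ℂ) / a) := by simp [hwdef]
    have hn : (0:ℝ) < ‖a‖ := norm_pos_iff.2 ha0
    rw [e, norm_neg, norm_div, Complex.norm_real, Real.norm_eq_abs,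
      abs_of_nonneg (by linarith [ht.2]), div_lt_iff₀ hn]
    rw [div_lt_iff₀ hδ0] at hzb
    linarith [ht.1]
  have hwre : ∀ t ∈ Ioc (0:ℝ) 1, 0 < (w t).re := by
    intro t ht
    have h1 := Complex.abs_re_le_norm (w t - 1)
    have h2 := hw1 t ht
    have h3 := (abs_le.1 h1).1
    simp at h3
    linarith
  have e1 : hausdorffC φ (hhF s) z = a ^ ((-s : ℝ) : ℂ) *
      ∫ t in Ioc (0:ℝ) 1, (g t : ℂ) * (w t) ^ ((-s : ℝ) : ℂ) := by
    unfold hausdorffC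
    rw [setIntegral_eq_of_subset_of_forall_sdiff_eq_zero (s := Ioc (0:ℝ) 1) measurableSet_Ioi
        (fun t ht => ht.1), ← integral_const_mul]
    · refine setIntegral_congr_fun measurableSet_Ioc ?_
      intro t ht
      have ht0 : (t:ℂ) ≠ 0 := by exact_mod_cast ht.1.ne'
      have e2 : 1 - Complex.I * (z / t) = ((t⁻¹ : ℝ) : ℂ) * (a * w t) := by
        simp only [hwdef]
        have : a * (1 - (1 - t) / a) = a - (1 - t) := by field_simp
        rw [this, ha]
        push_cast
        field_simp
        ring
      have e3 : 0 < (a * w t).re := by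
        have : a * w t = t - Complex.I * z := by
          simp only [hwdef]
          have : a * (1 - (1 - t) / a) = a - (1 - t) := by field_simp
          rw [this, ha]; ring
        rw [this]
        simp
        linarith [ht.1]
      simp only [hhF]
      rw [e2, hh_mul_cpow (by simpa using ht.1) e3, hh_mul_cpow hare (hwre t ht),
        ← Complex.ofReal_cpow (inv_nonneg.2 ht.1.le), Real.inv_rpow ht.1.le, Real.rpow_neg ht.1.le,
        inv_inv, Complex.real_smul]
      have e4 : ((g t : ℝ) : ℂ) = ((φ t / t : ℝ) : ℂ) * ((t ^ s : ℝ) : ℂ) := by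
        rw [← Complex.ofReal_mul]
        congr 1
        simp only [hg]
        rw [Real.rpow_sub_one ht.1.ne']
        ring
      rw [e4]; ring
    · intro t ht
      have : 1 < t := by
        by_contra hcon
        exact ht.2 ⟨ht.1, not_lt.1 hcon⟩
      simp [hsupp t this]
  have hgi : IntegrableOn (fun t => (g t : ℂ)) (Ioc (0:ℝ) 1) := hint.ofReal
  have hwm : Measurable fun t => (w t) ^ ((-s : ℝ) : ℂ) := by
    refine Measurable.pow_const ?_ _
    exact measurable_const.sub ((measurable_const.sub Complex.measurable_ofReal).div_const _)
  have hdi : IntegrableOn (fun t => (g t : ℂ) * ((w t) ^ ((-s : ℝ) : ℂ) - 1)) (Ioc (0:ℝ) 1) := by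
    refine Integrable.mul_bdd (c := η) hgi (hwm.sub_const 1).aestronglyMeasurable ?_
    filter_upwards [ae_restrict_mem measurableSet_Ioc] with t ht
    exact hδ _ (hw1 t ht)
  have e5 : ∫ t in Ioc (0:ℝ) 1, (g t : ℂ) * (w t) ^ ((-s : ℝ) : ℂ) =
      ((∫ t in Ioc (0:ℝ) 1, g t : ℝ) : ℂ) +
        ∫ t in Ioc (0:ℝ) 1, (g t : ℂ) * ((w t) ^ ((-s : ℝ) : ℂ) - 1) := by
    rw [← integral_complex_ofReal, ← integral_add hgi hdi]
    congr 1; ext t; ring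
  have hg0 : ∀ t ∈ Ioc (0:ℝ) 1, 0 ≤ g t := fun t ht =>
    mul_nonneg (Real.rpow_nonneg ht.1.le _) (hφ t)
  have hA0 : 0 ≤ ∫ t in Ioc (0:ℝ) 1, g t := setIntegral_nonneg measurableSet_Ioc hg0
  have e6 : ‖∫ t in Ioc (0:ℝ) 1, (g t : ℂ) * ((w t) ^ ((-s : ℝ) : ℂ) - 1)‖ ≤
      η * ∫ t in Ioc (0:ℝ) 1, g t := by
    rw [← integral_const_mul]
    refine norm_integral_le_of_norm_le (hint.const_mul η) ?_
    filter_upwards [ae_restrict_mem measurableSet_Ioc] with t ht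
    rw [norm_mul, Complex.norm_real, Real.norm_eq_abs, abs_of_nonneg (hg0 t ht), mul_comm]
    exact mul_le_mul_of_nonneg_right (hδ _ (hw1 t ht)) (hg0 t ht)
  have e7 : (1 - η) * (∫ t in Ioc (0:ℝ) 1, g t) ≤
      ‖∫ t in Ioc (0:ℝ) 1, (g t : ℂ) * (w t) ^ ((-s : ℝ) : ℂ)‖ := by
    rw [e5]
    have h1 := norm_sub_le_norm_add ((∫ t in Ioc (0:ℝ) 1, g t : ℝ) : ℂ)
        (∫ t in Ioc (0:ℝ) 1, (g t : ℂ) * ((w t) ^ ((-s : ℝ) : ℂ) - 1))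
    rw [Complex.norm_real, Real.norm_eq_abs, abs_of_nonneg hA0] at h1
    linarith
  rw [e1, norm_mul, mul_comm]
  exact mul_le_mul_of_nonneg_left e7 (norm_nonneg _)

lemma hh_even (g : ℝ → ℝ≥0∞) : ∫⁻ x, g |x| = 2 * ∫⁻ x in Ioi (0:ℝ), g x := by
  have h1 : ∫⁻ x in Ioi (0:ℝ), g |x| = ∫⁻ x in Ioi (0:ℝ), g x :=
    setLIntegral_congr_fun measurableSet_Ioi fun x hx => by simp only [abs_of_pos (mem_Ioi.1 hx)]
  have h2 : ∫⁻ x in Iio (0:ℝ), g |x| = ∫⁻ x in Ioi (0:ℝ), g x := by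
    rw [← h1]
    have := (Measure.measurePreserving_neg (volume : Measure ℝ)).setLIntegral_comp_preimage_emb
      (MeasurableEquiv.neg ℝ).measurableEmbedding (fun x => g |x|) (Ioi 0)
    simpa using this
  rw [← lintegral_add_compl _ (measurableSet_Ioi (a := (0:ℝ))), compl_Ioi,
    setLIntegral_congr Iio_ae_eq_Iic.symm, h1, h2, two_mul]

lemma hh_tail {X r : ℝ} (hX : 0 < X) (hr : 0 < r) :
    ∫⁻ x in Ioi X, ENNReal.ofReal (x ^ (-1 - r)) = ENNReal.ofReal (X ^ (-r) / r) := by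
  rw [← ofReal_integral_eq_lintegral_ofReal (integrableOn_Ioi_rpow_of_lt (by linarith) hX),
    integral_Ioi_rpow_of_lt (by linarith) hX]
  · congr 1
    have : -1 - r + 1 = -r := by ring
    rw [this, neg_div_neg_eq]
  · filter_upwards [ae_restrict_mem measurableSet_Ioi] with x hx
    exact Real.rpow_nonneg (hX.trans hx).le _

lemma hh_tail2 {X r : ℝ} (hX : 0 < X) (hr : 0 < r) :
    ∫⁻ x in Ioi X, ENNReal.ofReal ((x + 2) ^ (-1 - r)) = ENNReal.ofReal ((X + 2) ^ (-r) / r) := by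
  rw [← hh_tail (by linarith : 0 < X + 2) hr]
  have := (measurePreserving_add_right (volume : Measure ℝ) 2).setLIntegral_comp_preimage_emb
      (MeasurableEquiv.addRight (2:ℝ)).measurableEmbedding
      (fun x => ENNReal.ofReal (x ^ (-1 - r))) (Ioi (X + 2))
  rw [← this]
  simp

lemma hh_norm (s q r : ℝ) (hq : 0 ≤ q) (hsq : s * q = 1 + r) (z : ℂ) :
    ‖hhF s z‖ₑ ^ q = ENNReal.ofReal (‖1 - Complex.I * z‖ ^ (-1 - r)) := by
  rw [← ofReal_norm, ENNReal.ofReal_rpow_of_nonneg (norm_nonneg _) hq, hhF,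
    Complex.norm_cpow_real, ← Real.rpow_mul (norm_nonneg _)]
  congr 2; linarith

lemma hh_normF_le (s q r : ℝ) (hq : 0 ≤ q) (hsq : s * q = 1 + r) (hr : 0 < r) {X y : ℝ}
    (hX : 0 < X) (hy : 0 < y) :
    ∫⁻ x : ℝ, ‖hhF s (x + y * Complex.I)‖ₑ ^ q ≤ ENNReal.ofReal (2 * (X + X ^ (-r) / r)) := by
  set g : ℝ → ℝ≥0∞ := fun x => if x ≤ X then 1 else ENNReal.ofReal (x ^ (-1 - r)) with hg
  have h1 : ∀ x : ℝ, ‖hhF s (x + y * Complex.I)‖ₑ ^ q ≤ g |x| := by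
    intro x
    rw [hh_norm s q r hq hsq]
    have hre : (1 - Complex.I * (x + y * Complex.I) : ℂ).re = 1 + y := by simp
    have him : (1 - Complex.I * (x + y * Complex.I) : ℂ).im = -x := by simp
    have n1 : 1 ≤ ‖(1 - Complex.I * (x + y * Complex.I) : ℂ)‖ := by
      have := Complex.re_le_norm (1 - Complex.I * (x + y * Complex.I) : ℂ)
      rw [hre] at this; linarith
    have n2 : |x| ≤ ‖(1 - Complex.I * (x + y * Complex.I) : ℂ)‖ := by
      have := Complex.abs_im_le_norm (1 - Complex.I * (x + y * Complex.I) : ℂ)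
      rwa [him, abs_neg] at this
    simp only [hg]
    split_ifs with hc
    · rw [← ENNReal.ofReal_one]
      exact ENNReal.ofReal_le_ofReal (Real.rpow_le_one_of_one_le_of_nonpos n1 (by linarith))
    · exact ENNReal.ofReal_le_ofReal
        (Real.rpow_le_rpow_of_nonpos (by linarith) n2 (by linarith))
  refine (lintegral_mono h1).trans ?_
  rw [hh_even, ← Ioc_union_Ioi_eq_Ioi hX.le,
    lintegral_union measurableSet_Ioi (Ioc_disjoint_Ioi le_rfl)]
  have e1 : ∫⁻ x in Ioc 0 X, g x = ENNReal.ofReal X := by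
    rw [setLIntegral_congr_fun (g := fun _ => 1) measurableSet_Ioc
      (fun x hx => by simp [hg, hx.2])]
    simp
  have e2 : ∫⁻ x in Ioi X, g x = ENNReal.ofReal (X ^ (-r) / r) := by
    rw [← hh_tail hX hr]
    refine setLIntegral_congr_fun measurableSet_Ioi (fun x hx => ?_)
    simp [hg, not_le.2 (mem_Ioi.1 hx)]
  rw [e1, e2, ← ENNReal.ofReal_add hX.le (by positivity), ENNReal.ofReal_mul zero_le_two]
  simp

lemma hh_diff (s : ℝ) : DifferentiableOn ℂ (hhF s) {z : ℂ | 0 < z.im} := by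
  intro z hz
  refine DifferentiableAt.differentiableWithinAt ?_
  unfold hhF
  refine DifferentiableAt.cpow (by fun_prop) (by fun_prop) ?_
  left
  have : 0 < z.im := hz
  simp
  linarith

lemma hh_ineq (p : ℝ≥0∞) (hp : 1 ≤ p) (hptop : p ≠ ⊤)
    (φ : ℝ → ℝ) (hφ : ∀ t, 0 ≤ φ t)
    (hsupp : ∀ t : ℝ, 1 < t → φ t = 0) (s r : ℝ) (hr : 0 < r) (hsq : s * p.toReal = 1 + r)
    (hint : IntegrableOn (fun t : ℝ => t ^ (s - 1) * φ t) (Set.Ioc 0 1))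
    (η δ : ℝ) (hη : η ≤ 1) (hδ0 : 0 < δ) (hδ1 : δ ≤ 1)
    (hδ : ∀ w : ℂ, ‖w - 1‖ < δ → ‖w ^ ((-s : ℝ) : ℂ) - 1‖ ≤ η)
    (C : ℝ≥0∞) (hCtop : C ≠ ⊤) (hC : ∀ f : ℂ → ℂ, MemHardy p f →
        hardyNorm p (hausdorffC φ f) ≤ C * hardyNorm p f) :
    ((1 - η) * (∫ t in Ioc (0:ℝ) 1, t ^ (s - 1) * φ t)) ^ p.toReal * (1/δ + 2) ^ (-r) ≤
      C.toReal ^ p.toReal * (r * (1/δ) + (1/δ) ^ (-r)) := by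
  have hp0 : p ≠ 0 := (zero_lt_one.trans_le hp).ne'
  set q := p.toReal with hq
  have hq1 : 1 ≤ q := by
    have := ENNReal.toReal_mono hptop hp
    simpa using this
  have hq0 : 0 < q := by linarith
  set X := 1 / δ with hX
  have hX0 : 0 < X := by positivity
  set A := ∫ t in Ioc (0:ℝ) 1, t ^ (s - 1) * φ t with hA
  have hA0 : 0 ≤ A := setIntegral_nonneg measurableSet_Ioc fun t ht =>
    mul_nonneg (Real.rpow_nonneg ht.1.le _) (hφ t)
  set K := (1 - η) * A with hK
  have hK0 : 0 ≤ K := mul_nonneg (by linarith) hA0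
  set B := 2 * (X + X ^ (-r) / r) with hB
  have hB0 : 0 ≤ B := by positivity
  have hN : hardyNorm p (hhF s) ≤ ENNReal.ofReal B ^ (1 / q) := by
    unfold hardyNorm
    refine iSup₂_le fun y hy => ?_
    rw [eLpNorm_eq_lintegral_rpow_enorm_toReal hp0 hptop, ← hq]
    exact ENNReal.rpow_le_rpow (hh_normF_le s q r hq0.le hsq hr hX0 hy) (by positivity)
  have hmem : MemHardy p (hhF s) :=
    ⟨hh_diff s, hN.trans_lt (ENNReal.rpow_lt_top_of_nonneg (by positivity) ENNReal.ofReal_ne_top)⟩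
  have h1 := hC _ hmem
  have h2 : eLpNorm (fun x : ℝ => hausdorffC φ (hhF s) (x + (1:ℝ) * Complex.I)) p volume ≤
      C * ENNReal.ofReal B ^ (1 / q) := by
    refine le_trans ?_ (h1.trans (mul_le_mul_right hN _))
    unfold hardyNorm
    exact le_iSup₂ (f := fun (y : ℝ) (_ : y ∈ Set.Ioi (0:ℝ)) =>
        eLpNorm (fun x : ℝ => hausdorffC φ (hhF s) (x + y * Complex.I)) p volume) 1
          (mem_Ioi.2 one_pos)
  rw [eLpNorm_eq_lintegral_rpow_enorm_toReal hp0 hptop, ← hq] at h2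
  have h3 := ENNReal.rpow_le_rpow h2 hq0.le
  rw [← ENNReal.rpow_mul, ENNReal.mul_rpow_of_nonneg _ _ hq0.le, ← ENNReal.rpow_mul,
    one_div_mul_cancel hq0.ne', ENNReal.rpow_one, ENNReal.rpow_one] at h3
  set g : ℝ → ℝ≥0∞ := (Ioi X).indicator fun x =>
    ENNReal.ofReal (K ^ q) * ENNReal.ofReal ((x + 2) ^ (-1 - r)) with hg
  have h4 : ∫⁻ x, g |x| ≤
      ∫⁻ x : ℝ, ‖hausdorffC φ (hhF s) (x + (1:ℝ) * Complex.I)‖ₑ ^ q := by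
    refine lintegral_mono fun x => ?_
    by_cases hx : X < |x|
    · simp only [hg]
      rw [Set.indicator_of_mem (mem_Ioi.2 hx)]
      set z : ℂ := x + (1:ℝ) * Complex.I with hz
      have hre : (1 - Complex.I * z).re = 2 := by simp [hz]; norm_num
      have him : (1 - Complex.I * z).im = -x := by simp [hz]
      have n2 : |x| ≤ ‖1 - Complex.I * z‖ := by
        have := Complex.abs_im_le_norm (1 - Complex.I * z)
        rwa [him, abs_neg] at this
      have n3 : ‖1 - Complex.I * z‖ ≤ |x| + 2 := by
        have := Complex.norm_le_abs_re_add_abs_im (1 - Complex.I * z)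
        rw [hre, him, abs_neg] at this
        norm_num at this
        linarith
      have hpw := hh_pointwise φ hφ hsupp s hint η δ hδ0 hδ1 hδ z (by simp [hz])
        (lt_of_lt_of_le hx n2)
      have hpw2 : ENNReal.ofReal K * ‖hhF s z‖ₑ ≤ ‖hausdorffC φ (hhF s) z‖ₑ := by
        rw [← ofReal_norm, ← ofReal_norm, ← ENNReal.ofReal_mul hK0]
        exact ENNReal.ofReal_le_ofReal hpw
      refine le_trans ?_ (ENNReal.rpow_le_rpow hpw2 hq0.le)
      rw [ENNReal.mul_rpow_of_nonneg _ _ hq0.le, hh_norm s q r hq0.le hsq,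
        ENNReal.ofReal_rpow_of_nonneg hK0 hq0.le]
      refine mul_le_mul_right (ENNReal.ofReal_le_ofReal ?_) _
      exact Real.rpow_le_rpow_of_nonpos (by linarith) n3 (by linarith)
    · simp only [hg]
      rw [Set.indicator_of_notMem (by simpa using hx)]
      exact zero_le
  have h5 : ∫⁻ x, g |x| = ENNReal.ofReal (2 * (K ^ q * ((X + 2) ^ (-r) / r))) := by
    rw [hh_even, hg, lintegral_indicator measurableSet_Ioi,
      Measure.restrict_restrict measurableSet_Ioi,
      inter_eq_left.2 (Ioi_subset_Ioi hX0.le), lintegral_const_mul' _ _ ENNReal.ofReal_ne_top,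
      hh_tail2 hX0 hr, ENNReal.ofReal_mul zero_le_two, ENNReal.ofReal_mul (by positivity)]
    simp
  have h6 := h4.trans h3
  rw [h5, ← ENNReal.ofReal_toReal hCtop, ENNReal.ofReal_rpow_of_nonneg ENNReal.toReal_nonneg hq0.le,
    ← ENNReal.ofReal_mul (by positivity), ENNReal.ofReal_le_ofReal_iff (by positivity)] at h6
  have e1 : 2 * (K ^ q * ((X + 2) ^ (-r) / r)) = (K ^ q * (X + 2) ^ (-r)) * (2 / r) := by ring
  have e2 : C.toReal ^ q * B = (C.toReal ^ q * (r * X + X ^ (-r))) * (2 / r) := by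
    rw [hB]; field_simp
  rw [e1, e2] at h6
  exact le_of_mul_le_mul_right h6 (by positivity)

lemma hh_lower (p : ℝ≥0∞) (hp : 1 ≤ p) (hptop : p ≠ ⊤)
    (φ : ℝ → ℝ) (hφ : ∀ t, 0 ≤ φ t)
    (hsupp : ∀ t : ℝ, 1 < t → φ t = 0)
    (hint : IntegrableOn (fun t : ℝ => t ^ ((1 / p).toReal - 1) * φ t) (Set.Ioc 0 1))
    (C : ℝ≥0∞) (hCtop : C ≠ ⊤) (hC : ∀ f : ℂ → ℂ, MemHardy p f →
        hardyNorm p (hausdorffC φ f) ≤ C * hardyNorm p f) :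
    (∫ t in Ioc (0:ℝ) 1, t ^ ((1 / p).toReal - 1) * φ t) ≤ C.toReal := by
  set q := p.toReal with hq
  have hq1 : 1 ≤ q := by
    have := ENNReal.toReal_mono hptop hp
    simpa using this
  have hq0 : 0 < q := by linarith
  have ha : (1 / p).toReal = 1 / q := by simp [hq]
  rw [ha] at hint ⊢
  set M := ∫ t in Ioc (0:ℝ) 1, t ^ (1 / q - 1) * φ t with hM
  have hM0 : 0 ≤ M := setIntegral_nonneg measurableSet_Ioc fun t ht =>
    mul_nonneg (Real.rpow_nonneg ht.1.le _) (hφ t)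
  -- exponents
  set S : ℝ → ℝ := fun r => (1 + r) / q with hS
  have hSc : Tendsto S (𝓝[>] 0) (𝓝 (1 / q)) := by
    have : ContinuousAt S 0 := by fun_prop
    have h := this.tendsto
    simp only [hS, add_zero] at h
    exact h.mono_left nhdsWithin_le_nhds
  have hfac : ∀ r t : ℝ, 0 < t → t ^ (S r - 1) * φ t = t ^ (r / q) * (t ^ (1 / q - 1) * φ t) := by
    intro r t ht
    rw [← mul_assoc, ← Real.rpow_add ht]
    congr 2
    simp only [hS]; ring
  have hmeas : ∀ r : ℝ, AEStronglyMeasurable (fun t : ℝ => t ^ (S r - 1) * φ t)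
      (volume.restrict (Ioc 0 1)) := by
    intro r
    have : AEStronglyMeasurable (fun t : ℝ => t ^ (r / q) * (t ^ (1 / q - 1) * φ t))
      (volume.restrict (Ioc 0 1)) :=
      (measurable_id.pow_const (r / q)).aestronglyMeasurable.mul hint.aestronglyMeasurable
    refine this.congr ?_
    filter_upwards [ae_restrict_mem measurableSet_Ioc] with t ht
    exact (hfac r t ht.1).symm
  have hbd : ∀ r : ℝ, 0 < r → ∀ᵐ t ∂(volume.restrict (Ioc (0:ℝ) 1)),
      ‖t ^ (S r - 1) * φ t‖ ≤ t ^ (1 / q - 1) * φ t := by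
    intro r hr
    filter_upwards [ae_restrict_mem measurableSet_Ioc] with t ht
    have h0 : 0 ≤ t ^ (1 / q - 1) * φ t := mul_nonneg (Real.rpow_nonneg ht.1.le _) (hφ t)
    have h1 : 0 ≤ t ^ (r / q) := Real.rpow_nonneg ht.1.le _
    rw [hfac r t ht.1, Real.norm_eq_abs, abs_of_nonneg (mul_nonneg h1 h0)]
    exact mul_le_of_le_one_left h0 (Real.rpow_le_one ht.1.le ht.2 (by positivity))
  have hintr : ∀ r : ℝ, 0 < r → IntegrableOn (fun t : ℝ => t ^ (S r - 1) * φ t) (Ioc 0 1) :=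
    fun r hr => Integrable.mono' hint (hmeas r) (hbd r hr)
  have hlimA : Tendsto (fun r => ∫ t in Ioc (0:ℝ) 1, t ^ (S r - 1) * φ t) (𝓝[>] 0) (𝓝 M) := by
    refine tendsto_integral_filter_of_dominated_convergence _
      (Eventually.of_forall hmeas) ?_ hint ?_
    · filter_upwards [self_mem_nhdsWithin] with r hr
      exact hbd r hr
    · filter_upwards [ae_restrict_mem measurableSet_Ioc] with t ht
      refine Tendsto.mul_const _ ?_
      exact (Real.continuous_const_rpow ht.1.ne').continuousAt.tendsto.comp (hSc.sub_const 1)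
  -- fixed error
  have hη : ∀ η : ℝ, 0 < η → η < 1 → (1 - η) * M ≤ C.toReal := by
    intro η h0 h1
    have hcont : Tendsto (fun x : ℂ × ℂ => x.1 ^ x.2) (𝓝 ((1:ℂ), ((-(1/q) : ℝ) : ℂ))) (𝓝 1) := by
      have := (continuousAt_cpow (p := ((1:ℂ), ((-(1/q) : ℝ) : ℂ))) (by simp)).tendsto
      simpa using this
    have hev := Metric.tendsto_nhds.1 hcont η h0
    rw [nhds_prod_eq] at hev
    obtain ⟨P, hP, Q, hQ, hPQ⟩ := eventually_prod_iff.1 hev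
    obtain ⟨δ', hδ'0, hδ'⟩ := Metric.eventually_nhds_iff.1 hP
    set δ := min δ' 1 with hδ
    have hδ0 : 0 < δ := lt_min hδ'0 one_pos
    have hQ' : ∀ᶠ r in 𝓝[>] (0:ℝ), Q ((-(S r) : ℝ) : ℂ) :=
      ((Complex.continuous_ofReal.tendsto _).comp hSc.neg).eventually hQ
    have hineq : ∀ᶠ r in 𝓝[>] (0:ℝ),
        ((1 - η) * (∫ t in Ioc (0:ℝ) 1, t ^ (S r - 1) * φ t)) ^ q * (1/δ + 2) ^ (-r) ≤
          C.toReal ^ q * (r * (1/δ) + (1/δ) ^ (-r)) := by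
      filter_upwards [hQ', self_mem_nhdsWithin] with r hQr hr
      have hr : 0 < r := hr
      refine hh_ineq p hp hptop φ hφ hsupp (S r) r hr ?_ (hintr r hr) η δ h1.le hδ0
        (min_le_right _ _) ?_ C hCtop hC
      · exact div_mul_cancel₀ _ hq0.ne'
      · intro w hw
        have := hPQ (hδ' (y := w) (by rw [dist_eq_norm]; exact hw.trans_le (min_le_left _ _))) hQr
        rw [dist_eq_norm] at this
        exact this.le
    have hpow : ∀ b : ℝ, 0 < b → Tendsto (fun r : ℝ => b ^ (-r)) (𝓝[>] 0) (𝓝 1) := by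
      intro b hb
      have : ContinuousAt (fun r : ℝ => b ^ (-r)) 0 :=
        ((Real.continuous_const_rpow hb.ne').comp continuous_neg).continuousAt
      have h := this.tendsto
      simp only [neg_zero, Real.rpow_zero] at h
      exact h.mono_left nhdsWithin_le_nhds
    have hid : Tendsto (fun r : ℝ => r) (𝓝[>] 0) (𝓝 0) := nhdsWithin_le_nhds
    have hL := (((hlimA.const_mul (1 - η)).rpow_const (p := q) (Or.inr hq0.le)).mul
      (hpow (1/δ + 2) (by positivity)))
    have hR := ((hid.mul_const (1/δ)).add (hpow (1/δ) (by positivity))).const_mul (C.toReal ^ q)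
    have := le_of_tendsto_of_tendsto hL hR hineq
    rw [zero_mul, zero_add, mul_one, mul_one] at this
    exact (Real.rpow_le_rpow_iff (mul_nonneg (by linarith) hM0) ENNReal.toReal_nonneg hq0).1 this
  have hlim : Tendsto (fun η : ℝ => (1 - η) * M) (𝓝[>] 0) (𝓝 M) := by
    have : ContinuousAt (fun η : ℝ => (1 - η) * M) 0 := by fun_prop
    have h := this.tendsto
    simp only [sub_zero, one_mul] at h
    exact h.mono_left nhdsWithin_le_nhds
  refine le_of_tendsto hlim ?_
  filter_upwards [Ioo_mem_nhdsGT (zero_lt_one' ℝ)] with η hmem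
  exact hη η hmem.1 hmem.2

/-- Lemma 2.3(ii): if `φ` is supported in `[0,1]` and `∫₀^1 t^{1/p-1} φ(t) dt < ∞`, then
the operator norm of `𝓗_φ` on `H_a^p(ℂ₊)` equals `∫₀^1 t^{1/p-1} φ(t) dt`, `p ∈ [1,∞)`. -/
theorem hausdorff_hardy_norm_eq_of_support (p : ℝ≥0∞) (hp : 1 ≤ p) (hptop : p ≠ ⊤)
    (φ : ℝ → ℝ) (hφ : ∀ t, 0 ≤ φ t)
    (hloc : LocallyIntegrableOn φ (Set.Ioi 0))
    (hsupp : ∀ t : ℝ, 1 < t → φ t = 0)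
    (hint : IntegrableOn (fun t : ℝ => t ^ ((1 / p).toReal - 1) * φ t) (Set.Ioc 0 1)) :
    sInf {C : ℝ≥0∞ | ∀ f : ℂ → ℂ, MemHardy p f →
        hardyNorm p (hausdorffC φ f) ≤ C * hardyNorm p f} =
      ENNReal.ofReal (∫ t in Set.Ioc (0 : ℝ) 1, t ^ ((1 / p).toReal - 1) * φ t) := by

  refine le_antisymm ?_ ?_
  · refine sInf_le ?_
    intro f hf
    refine iSup₂_le fun y hy => ?_
    exact hh_upper p hp hptop φ hφ hsupp hint f hf.1 hy
  · refine le_sInf ?_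
    intro C hC
    by_cases hCtop : C = ⊤
    · rw [hCtop]; exact le_top
    · exact ENNReal.ofReal_le_of_le_toReal
        (hh_lower p hp hptop φ hφ hsupp hint C hCtop hC)
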